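/- arXiv:2209.10891 — 2 statements merged into one kernel-verified Lean document; each statement's English description precedes it below -/
import Mathlib

section
/- Let K be an algebraically closed field of uncountable cardinality whose transcendence degree over its prime subfield equals #K. Let X be a relatively algebraically closed subfield containing the relative algebraic closure of the prime field, of transcendence degree strictly less than #K, and let Y₁ and Y₂ be two acceptable extensions of X inside K. Then every field automorphism f of X extends to a field isomorphism from Y₁ onto Y₂; in particular (taking f the identity) there exists an automorphism of K fixing X pointwise and mapping Y₁ onto Y₂. -/
open Cardinal

/-- `cl A`: the set of elements of `K` algebraic over the subfield generated by `A`
(over the prime field). -/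
def cl (K : Type*) [Field K] (A : Set K) : Set K :=
  {x : K | IsAlgebraic (Subfield.closure A) x}

/-- The transcendence degree of `K` over its prime subfield equals `#K`. -/
def FullTrdeg (K : Type*) [Field K] : Prop :=
  ∃ s : Set K, IsTranscendenceBasis (⊥ : Subfield K) ((↑) : s → K) ∧ #s = #K

/-- A subfield `X` of `K` is relatively algebraically closed in `K`. -/
def RelAlgClosed {K : Type*} [Field K] (X : Subfield K) : Prop :=
  ∀ x : K, IsAlgebraic X x → x ∈ X

/-- `X` contains the relative algebraic closure of the prime field in `K`. -/
def ContainsBotAlg {K : Type*} [Field K] (X : Subfield K) : Prop :=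
  ∀ x : K, IsAlgebraic (⊥ : Subfield K) x → x ∈ X

/-- The subfield `X` has transcendence degree `< #K` over the prime field. -/
def SmallTrdeg {K : Type*} [Field K] (X : Subfield K) : Prop :=
  ∃ s : Set X, IsTranscendenceBasis (⊥ : Subfield ↥X) ((↑) : s → ↥X) ∧ #s < #K

/-- `X ⊆ Y` is an acceptable extension: `Y = cl (X ∪ A)` for some countably infinite
set `A` algebraically independent over `X`. -/
def Acceptable {K : Type*} [Field K] (X Y : Subfield K) : Prop :=
  X ≤ Y ∧ ∃ A : Set K, A.Countable ∧ A.Infinite ∧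
    AlgebraicIndependent ↥X ((↑) : A → K) ∧ (Y : Set K) = cl K ((X : Set K) ∪ A)

/-- Two algebraically closed fields over isomorphic base rings, with equipotent transcendence
bases, are isomorphic by an isomorphism extending that of the base rings and carrying one basis
to the other. -/
theorem IsTranscendenceBasis.exists_ringEquiv {R S K L ι κ : Type*} [CommRing R] [CommRing S]
    [Field K] [Field L] [Algebra R K] [Algebra S L] [IsAlgClosed K] [IsAlgClosed L]
    {v : ι → K} {w : κ → L} (hv : IsTranscendenceBasis R v) (hw : IsTranscendenceBasis S w)
    (f : R ≃+* S) (e : ι ≃ κ) :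
    ∃ F : K ≃+* L, (∀ r, F (algebraMap R K r) = algebraMap S L (f r)) ∧
      ∀ i, F (v i) = w (e i) := by
  let := IsAlgClosed.isAlgClosure_of_transcendence_basis v hv
  let := IsAlgClosed.isAlgClosure_of_transcendence_basis w hw
  let g : Algebra.adjoin R (Set.range v) ≃+* Algebra.adjoin S (Set.range w) :=
    hv.1.aevalEquiv.symm.toRingEquiv.trans <|
      (MvPolynomial.mapEquiv ι f).trans <|
      (MvPolynomial.renameEquiv S e).toRingEquiv.trans hw.1.aevalEquiv.toRingEquiv
  have key (p : MvPolynomial ι R) :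
      IsAlgClosure.equivOfEquiv K L g (MvPolynomial.aeval v p) =
        MvPolynomial.aeval w (MvPolynomial.rename e (MvPolynomial.map (f : R →+* S) p)) := by
    rw [← hv.1.algebraMap_aevalEquiv, IsAlgClosure.equivOfEquiv_algebraMap,
      ← hw.1.algebraMap_aevalEquiv]
    simp [g]
  refine ⟨IsAlgClosure.equivOfEquiv K L g, fun r ↦ ?_, fun i ↦ ?_⟩
  · simpa using key (MvPolynomial.C r)
  · simpa using key (MvPolynomial.X i)

/-- A bijection between two subsets with equipotent complements extends to the ambient sets. -/
theorem Set.exists_equiv_extending {α β : Type*} {s t : Set α} {s' t' : Set β} (hst : s ⊆ t)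
    (hst' : s' ⊆ t') (e : s ≃ s') (e' : (t \ s : Set α) ≃ (t' \ s' : Set β)) :
    ∃ g : t ≃ t', ∀ x : t, ∀ hx : (x : α) ∈ s, (g x : β) = e ⟨x, hx⟩ := by
  classical
  refine ⟨(Equiv.Set.sumDiffSubset hst).symm.trans <|
    (Equiv.sumCongr e e').trans (Equiv.Set.sumDiffSubset hst'), fun x hx ↦ ?_⟩
  simp [Equiv.Set.sumDiffSubset_symm_apply_of_mem hst hx]

/-- A field automorphism carrying `A` into `B` carries `cl A` into `cl B`. -/
theorem map_mem_cl {K : Type*} [Field K] (F : K ≃+* K) {A B : Set K} (h : ∀ a ∈ A, F a ∈ B)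
    {x : K} (hx : x ∈ cl K A) : F x ∈ cl K B := by
  have hF (y : Subfield.closure A) : F y ∈ Subfield.closure B := by
    have : Subfield.closure A ≤ (Subfield.closure B).comap (F : K →+* K) :=
      Subfield.closure_le.2 fun a ha ↦ Subfield.subset_closure (h a ha)
    exact this y.2
  exact IsAlgebraic.ringHom_of_comp_eq
    (((F : K →+* K).comp (Subfield.closure A).subtype).codRestrict (Subfield.closure B) hF)
    (F : K →+* K) hx (RingHom.injective _) rfl

theorem IsTranscendenceBasis.cardinalMk_le.{u} {F E : Type u} [Field F] [Field E] [Algebra F E]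
    {s : Set E} (hs : IsTranscendenceBasis F ((↑) : s → E)) : #E ≤ #F ⊔ #s ⊔ ℵ₀ := by
  have := hs.isAlgebraic_field
  rw [Subtype.range_coe] at this
  refine (Algebra.IsAlgebraic.cardinalMk_le_max (IntermediateField.adjoin F s) E).trans ?_
  exact max_le (IntermediateField.cardinalMk_adjoin_le F s) le_sup_right

theorem SmallTrdeg.cardinalMk_lt {K : Type*} [Field K] [Uncountable K] {X : Subfield K}
    (hX : SmallTrdeg X) : #X < #K := by
  obtain ⟨s, hs, hsK⟩ := hX
  have hK : ℵ₀ < #K := Cardinal.aleph0_lt_mk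
  have hbot : #(⊥ : Subfield X) ≤ ℵ₀ := by
    simpa using Subfield.cardinalMk_closure_le_max (∅ : Set X)
  exact hs.cardinalMk_le.trans_lt (max_lt (max_lt (hbot.trans_lt hK) hsK) hK)

/-- An algebraically independent countable set extends to a transcendence basis with `#K` new
elements, over a subfield of cardinality less than `#K`. -/
theorem exists_isTranscendenceBasis_mk_diff {K : Type*} [Field K] [IsAlgClosed K] [Uncountable K]
    {X : Subfield K} (hX : #X < #K) {A : Set K} (hA : A.Countable)
    (hind : AlgebraicIndependent X ((↑) : A → K)) :
    ∃ B, A ⊆ B ∧ IsTranscendenceBasis X ((↑) : B → K) ∧ #(B \ A : Set K) = #K := by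
  obtain ⟨B, hAB, hB⟩ := exists_isTranscendenceBasis_superset (R := X) (s := A) hind
  refine ⟨B, hAB, hB, (mk_set_le _).antisymm (le_of_not_gt fun hlt ↦ ?_)⟩
  have hK : ℵ₀ < #K := Cardinal.aleph0_lt_mk
  have hBlt : #B < #K := by
    rw [← Cardinal.mk_sdiff_add_mk hAB]
    exact add_lt_of_lt hK.le hlt (hA.le_aleph0.trans_lt hK)
  have := IsAlgClosed.cardinal_le_max_transcendence_basis' _ hB
  exact this.not_gt (max_lt (max_lt hX hBlt) hK)

/-- An automorphism of `X` extends to an automorphism of `K` that carries one acceptable extension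
of `X` onto another. -/
theorem Acceptable.exists_ringEquiv {K : Type*} [Field K] [IsAlgClosed K] [Uncountable K]
    {X Y₁ Y₂ : Subfield K} (hX : #X < #K) (hY₁ : Acceptable X Y₁) (hY₂ : Acceptable X Y₂)
    (f : X ≃+* X) :
    ∃ F : K ≃+* K, (∀ x : X, F x = f x) ∧ Y₁.map (F : K →+* K) = Y₂ := by
  obtain ⟨-, A₁, hc₁, hi₁, hind₁, hcl₁⟩ := hY₁
  obtain ⟨-, A₂, hc₂, hi₂, hind₂, hcl₂⟩ := hY₂
  obtain ⟨B₁, hAB₁, hB₁, hd₁⟩ := exists_isTranscendenceBasis_mk_diff hX hc₁ hind₁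
  obtain ⟨B₂, hAB₂, hB₂, hd₂⟩ := exists_isTranscendenceBasis_mk_diff hX hc₂ hind₂
  have := hc₁.to_subtype
  have := hc₂.to_subtype
  have := hi₁.to_subtype
  have := hi₂.to_subtype
  obtain ⟨e⟩ : Nonempty (A₁ ≃ A₂) := nonempty_equiv_of_countable
  obtain ⟨e'⟩ := Cardinal.eq.1 (hd₁.trans hd₂.symm)
  obtain ⟨g, hg⟩ := Set.exists_equiv_extending hAB₁ hAB₂ e e'
  obtain ⟨F, hF, hFg⟩ := hB₁.exists_ringEquiv hB₂ f g
  have hFX (x : X) : F x = f x := hF x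
  have hFA (a : A₁) : F a = e a := (hFg ⟨a, hAB₁ a.2⟩).trans (hg ⟨a, hAB₁ a.2⟩ a.2)
  refine ⟨F, hFX, SetLike.coe_injective ?_⟩
  rw [Subfield.coe_map, hcl₁, hcl₂]
  refine Set.Subset.antisymm ?_ fun y hy ↦ ⟨F.symm y, ?_, F.apply_symm_apply y⟩
  · rintro _ ⟨x, hx, rfl⟩
    refine map_mem_cl F ?_ hx
    rintro a (ha | ha)
    · exact .inl (hFX ⟨a, ha⟩ ▸ (f ⟨a, ha⟩).2)
    · exact .inr (hFA ⟨a, ha⟩ ▸ (e ⟨a, ha⟩).2)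
  · refine map_mem_cl F.symm ?_ hy
    rintro a (ha | ha)
    · have h := hFX (f.symm ⟨a, ha⟩)
      rw [f.apply_symm_apply] at h
      exact .inl (F.symm_apply_eq.2 h.symm ▸ (f.symm ⟨a, ha⟩).2)
    · have h := hFA (e.symm ⟨a, ha⟩)
      rw [e.apply_symm_apply] at h
      exact .inr (F.symm_apply_eq.2 h.symm ▸ (e.symm ⟨a, ha⟩).2)

/-- Any two acceptable extensions `Y₁`, `Y₂` of `X` are isomorphic over any automorphism
`f` of `X`; in particular (for `f` the identity) they are conjugate by an automorphism of
`K` fixing `X` pointwise. -/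
theorem acceptable_extensions_conjugate (K : Type*) [Field K] [IsAlgClosed K]
    [Uncountable K] (htr : FullTrdeg K)
    (X : Subfield K) (hX1 : RelAlgClosed X) (hX2 : ContainsBotAlg X) (hX3 : SmallTrdeg X)
    (Y₁ Y₂ : Subfield K) (hY₁ : Acceptable X Y₁) (hY₂ : Acceptable X Y₂)
    (f : ↥X ≃+* ↥X) :
    (∃ φ : ↥Y₁ ≃+* ↥Y₂, ∀ x (hx : x ∈ X), (φ ⟨x, hY₁.1 hx⟩ : K) = (f ⟨x, hx⟩ : K)) ∧
    (∃ F : K ≃+* K, (∀ x ∈ X, F x = x) ∧ Y₁.map (F : K →+* K) = Y₂) := by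
  have hX := hX3.cardinalMk_lt
  constructor
  · obtain ⟨F, hF, hFY⟩ := hY₁.exists_ringEquiv hX hY₂ f
    subst hFY
    exact ⟨Y₁.equivMapOfInjective (F : K →+* K) F.injective, fun x hx ↦ hF ⟨x, hx⟩⟩
  · obtain ⟨F, hF, hFY⟩ := hY₁.exists_ringEquiv hX hY₂ (RingEquiv.refl X)
    exact ⟨F, fun x hx ↦ hF ⟨x, hx⟩, hFY⟩
end

section
/- Let K be an algebraically closed field of uncountable cardinality whose transcendence degree over its prime subfield equals #K, and let τ be an unbounded automorphism of K fixing pointwise the relative algebraic closure of the prime field. Let ν be an automorphism of K and let X be a relatively algebraically closed subfield of K containing the relative algebraic closure of the prime field, of transcendence degree strictly less than #K, with τ(X) = X and ν(X) = X, and suppose ν|_X = Ψ_X(f₁,f₂) ∘ Ψ_X(f₃,f₄)⁻¹ for some automorphisms f₁, f₂, f₃, f₄ of X. Then for every element a ∈ K there exist an acceptable extension Y of X with a ∈ Y, τ(Y) = Y and ν(Y) = Y, and automorphisms f'₁, f'₂, f'₃, f'₄ of Y extending f₁, f₂, f₃, f₄ respectively, such that ν|_Y = Ψ_Y(f'₁,f'₂)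 ∘ Ψ_Y(f'₃,f'₄)⁻¹. -/
open Cardinal

/-- An automorphism `τ` of `K` is bounded if there is a subset `A` of `K` of
cardinality `< #K` such that `τ b ∈ cl (A ∪ {b})` for every `b ∉ cl A`. -/
def IsBounded {K : Type*} [Field K] (τ : K ≃+* K) : Prop :=
  ∃ A : Set K, #A < #K ∧ ∀ b : K, b ∉ cl K A → τ b ∈ cl K (A ∪ {b})

/-- The restriction of `τ` to a `τ`-invariant subfield `X`, as an automorphism of `X`. -/
def restrict {K : Type*} [Field K] (τ : K ≃+* K) (X : Subfield K)
    (hX : X.map (τ : K →+* K) = X) : ↥X ≃+* ↥X where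
  toFun x := ⟨τ x, by
    have h : τ (x : K) ∈ X.map (τ : K →+* K) := Subfield.mem_map.mpr ⟨x, x.2, rfl⟩
    rwa [hX] at h⟩
  invFun y := ⟨τ.symm y, by
    have hy : (y : K) ∈ X.map (τ : K →+* K) := by rw [hX]; exact y.2
    obtain ⟨z, hz, hzy⟩ := Subfield.mem_map.mp hy
    have hzz : τ.symm y = z := by rw [← hzy]; exact τ.symm_apply_apply z
    rw [hzz]; exact hz⟩
  left_inv x := Subtype.ext (τ.symm_apply_apply x)
  right_inv y := Subtype.ext (τ.apply_symm_apply y)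
  map_mul' x y := Subtype.ext (by
    show τ ((x : K) * (y : K)) = τ (x : K) * τ (y : K)
    exact map_mul τ (x : K) (y : K))
  map_add' x y := Subtype.ext (by
    show τ ((x : K) + (y : K)) = τ (x : K) + τ (y : K)
    exact map_add τ (x : K) (y : K))

/-- `psi t f g = Ψ(f,g) = f ∘ t ∘ g ∘ t⁻¹ ∘ g⁻¹ ∘ f⁻¹` (`RingEquiv.trans a b` applies
`a` first), so `psi t f g x = f (t (g (t⁻¹ (g⁻¹ (f⁻¹ x)))))`. -/
def psi {R : Type*} [Field R] (t f g : R ≃+* R) : R ≃+* R :=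
  ((((f.symm.trans g.symm).trans t.symm).trans g).trans t).trans f

universe u

open scoped TensorProduct

/-- A nonzero element of a finitely generated domain over an algebraically closed field
is nonzero at some rational point. -/
theorem exists_algHom_ne_zero {k A : Type*} [Field k] [IsAlgClosed k] [CommRing A] [IsDomain A]
    [Algebra k A] [Algebra.FiniteType k A] {a : A} (ha : a ≠ 0) :
    ∃ θ : A →ₐ[k] k, θ a ≠ 0 := by
  let L := Localization.Away a
  have hL : Nontrivial L := (IsLocalization.injective L
    (powers_le_nonZeroDivisors_of_noZeroDivisors ha)).nontrivial
  obtain ⟨m, hm⟩ := Ideal.exists_maximal L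
  let : Field (L ⧸ m) := Ideal.Quotient.field m
  have : Algebra.FiniteType k L := inferInstance
  have : Algebra.FiniteType k (L ⧸ m) := .of_surjective (Ideal.Quotient.mkₐ k m)
    (Ideal.Quotient.mkₐ_surjective k m)
  have : Module.Finite k (L ⧸ m) := finite_of_finite_type_of_isJacobsonRing k _
  have hb : Function.Bijective (algebraMap k (L ⧸ m)) :=
    IsAlgClosed.algebraMap_bijective_of_isIntegral
  let e : k ≃ₐ[k] L ⧸ m := AlgEquiv.ofBijective (Algebra.ofId k _) hb
  refine ⟨(e.symm : (L ⧸ m) →ₐ[k] k).comp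
    ((Ideal.Quotient.mkₐ k m).comp (IsScalarTower.toAlgHom k A L)), ?_⟩
  have hu : IsUnit (algebraMap A L a) := IsLocalization.Away.algebraMap_isUnit a
  exact (hu.map ((e.symm : (L ⧸ m) →ₐ[k] k).comp (Ideal.Quotient.mkₐ k m))).ne_zero

theorem noZeroDivisors_tensorProduct_of_finiteType (k A B : Type*) [Field k] [IsAlgClosed k]
    [CommRing A] [IsDomain A] [CommRing B] [IsDomain B] [Algebra k A] [Algebra k B]
    [Algebra.FiniteType k A] : NoZeroDivisors (A ⊗[k] B) where
  eq_zero_or_eq_zero_of_mul_eq_zero {x y} hxy := by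
    by_contra! h
    let β := Module.Basis.ofVectorSpace k B
    let βA := β.baseChange A
    have key (z : A ⊗[k] B) (hz : z ≠ 0) : ∃ a : A, a ≠ 0 ∧ ∀ θ : A →ₐ[k] k,
        Algebra.TensorProduct.lift ((Algebra.ofId k B).comp θ) (AlgHom.id k B)
          (fun _ _ => .all _ _) z = 0 → θ a = 0 := by
      have hz' : βA.repr z ≠ 0 := by simpa using hz
      obtain ⟨i, hi⟩ := Finsupp.ne_iff.mp hz'
      refine ⟨βA.repr z i, hi, fun θ hθ => ?_⟩
      have hsum : z = ∑ j ∈ (βA.repr z).support, βA.repr z j • βA j := by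
        conv_lhs => rw [← βA.linearCombination_repr z]
        rfl
      rw [hsum, map_sum] at hθ
      have h2 : ∑ j ∈ (βA.repr z).support, θ (βA.repr z j) • β j = 0 := by
        rw [← hθ]
        refine Finset.sum_congr rfl fun j _ => ?_
        simp [βA, Module.Basis.baseChange_apply, Algebra.smul_def, Algebra.ofId_apply]
      exact linearIndependent_iff'.mp β.linearIndependent _ _ h2 i (Finsupp.mem_support_iff.mpr hi)
    obtain ⟨a, ha, ha'⟩ := key x h.1
    obtain ⟨b, hb, hb'⟩ := key y h.2
    obtain ⟨θ, hθ⟩ := exists_algHom_ne_zero (k := k) (mul_ne_zero ha hb)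
    have h3 := congrArg (Algebra.TensorProduct.lift ((Algebra.ofId k B).comp θ) (AlgHom.id k B)
          (fun _ _ => .all _ _)) hxy
    rw [map_mul, map_zero] at h3
    rw [map_mul] at hθ
    rcases mul_eq_zero.mp h3 with h4 | h4
    · exact hθ (by rw [ha' θ h4, zero_mul])
    · exact hθ (by rw [hb' θ h4, mul_zero])

/-- Over an algebraically closed field, the tensor product of two domains is a domain. -/
theorem isDomain_tensorProduct (k A B : Type*) [Field k] [IsAlgClosed k]
    [CommRing A] [IsDomain A] [CommRing B] [IsDomain B] [Algebra k A] [Algebra k B] :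
    IsDomain (A ⊗[k] B) := by
  have hnz : NoZeroDivisors (A ⊗[k] B) := by
    refine ⟨fun {x y} hxy => ?_⟩
    obtain ⟨M, hM, hsub⟩ := TensorProduct.exists_finite_submodule_left_of_setFinite
      ({x, y} : Set (A ⊗[k] B)) (Set.toFinite _)
    obtain ⟨t, ht⟩ := (Module.Finite.iff_fg.mp hM)
    let S : Subalgebra k A := Algebra.adjoin k (t : Set A)
    have hMS : M ≤ Subalgebra.toSubmodule S := ht ▸ Submodule.span_le.mpr Algebra.subset_adjoin
    have : Algebra.FiniteType k S := S.fg_iff_finiteType.mp ⟨t, rfl⟩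
    have hnz := noZeroDivisors_tensorProduct_of_finiteType k S B
    let φ : S ⊗[k] B →ₐ[k] A ⊗[k] B := Algebra.TensorProduct.map S.val (AlgHom.id k B)
    have hφ : Function.Injective φ :=
      Module.Flat.rTensor_preserves_injective_linearMap (M := B) S.val.toLinearMap
        Subtype.val_injective
    have hr : ∀ z ∈ ({x, y} : Set (A ⊗[k] B)), ∃ z', φ z' = z := by
      intro z hz
      obtain ⟨w, hw⟩ := hsub hz
      refine ⟨LinearMap.rTensor B (Submodule.inclusion hMS) w, ?_⟩
      change LinearMap.rTensor B S.val.toLinearMap _ = z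
      rw [← hw, ← LinearMap.comp_apply, ← LinearMap.rTensor_comp]
      rfl
    obtain ⟨x', rfl⟩ := hr x (by simp)
    obtain ⟨y', rfl⟩ := hr y (by simp)
    rw [← map_mul, map_eq_zero_iff _ hφ] at hxy
    rcases mul_eq_zero.mp hxy with h | h <;> simp [h]
  have : Nontrivial (A ⊗[k] B) := inferInstance
  exact NoZeroDivisors.to_isDomain _

/-- If `B` is algebraic over `k[c]` and the image of `c` in `K` is algebraically independent
over `A`, then `A` and `B` are linearly disjoint over the algebraically closed field `k`. -/
theorem injective_tensorProduct_lift {k A B K κ : Type*} [Field k] [IsAlgClosed k]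
    [CommRing A] [IsDomain A] [CommRing B] [IsDomain B] [Field K] [Algebra k A] [Algebra k B]
    [Algebra k K] [Algebra A K] [IsScalarTower k A K] (hB : B →ₐ[k] K) (c : κ → B)
    (hc : Algebra.IsAlgebraic (Algebra.adjoin k (Set.range c)) B)
    (hind : AlgebraicIndependent A (hB ∘ c)) :
    Function.Injective (Algebra.TensorProduct.lift (Algebra.ofId A K) hB
      (fun _ _ => .all _ _)) := by
  set m := Algebra.TensorProduct.lift (Algebra.ofId A K) hB (fun _ _ => .all _ _) with hm
  have hdom := isDomain_tensorProduct k A B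
  let c' : κ → A ⊗[k] B := fun i => 1 ⊗ₜ c i
  have hmc : m ∘ c' = hB ∘ c := by ext i; simp [hm, c']
  let S := Algebra.adjoin A (Set.range c')
  let incB : B →ₐ[k] A ⊗[k] B := Algebra.TensorProduct.includeRight
  have hincB : Function.Injective incB :=
    Algebra.TensorProduct.includeRight_injective (FaithfulSMul.algebraMap_injective k A)
  have hle : (Algebra.adjoin k (Set.range c)).map incB ≤ S.restrictScalars k := by
    rw [AlgHom.map_adjoin]
    refine Algebra.adjoin_le ?_
    rintro _ ⟨_, ⟨i, rfl⟩, rfl⟩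
    have hi : c' i ∈ S := Algebra.subset_adjoin (Set.mem_range_self i)
    exact hi
  have halgB (b : B) : IsAlgebraic S (incB b) := by
    let g : Algebra.adjoin k (Set.range c) →+* S :=
      (incB.toRingHom.comp (algebraMap (Algebra.adjoin k (Set.range c)) B)).codRestrict S
        (fun x => hle ⟨x, x.2, rfl⟩)
    refine (hc.isAlgebraic b).ringHom_of_comp_eq g incB.toRingHom ?_ ?_
    · intro x y hxy
      exact Subtype.ext (hincB (congrArg Subtype.val hxy))
    · rfl
  have halg (x : A ⊗[k] B) : IsAlgebraic S x := by
    induction x with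
    | zero => exact isAlgebraic_zero
    | add x y hx hy => exact hx.add hy
    | tmul a b =>
      have : a ⊗ₜ[k] b = algebraMap S (A ⊗[k] B) (algebraMap A S a) * incB b := by
        rw [← IsScalarTower.algebraMap_apply]
        simp [incB, Algebra.TensorProduct.algebraMap_apply]
      rw [this]
      exact isAlgebraic_algebraMap _ |>.mul (halgB b)
  rw [injective_iff_map_eq_zero]
  intro x hx
  by_contra hne
  obtain ⟨s, hs, hdvd⟩ := (halg x).exists_nonzero_dvd (mem_nonZeroDivisors_of_ne_zero hne)
  have hms : m s = 0 := by
    obtain ⟨y, hy⟩ := hdvd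
    have : (s : A ⊗[k] B) = x * y := hy
    rw [this, map_mul, hx, zero_mul]
  obtain ⟨p, hp⟩ : (s : A ⊗[k] B) ∈ (MvPolynomial.aeval c' : MvPolynomial κ A →ₐ[A] _).range := by
    rw [← Algebra.adjoin_range_eq_range_aeval]; exact s.2
  apply hs
  have hp0 : p = 0 := by
    apply hind.eq_zero_of_aeval_eq_zero
    rw [← hmc, ← hms, ← hp]
    exact (MvPolynomial.comp_aeval_apply c' m p).symm
  ext
  rw [← hp, hp0]; simp

/-- Two embeddings of a small ring into an uncountable algebraically closed field are conjugate
under an automorphism of the field. -/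
theorem exists_ringEquiv_comp_eq {R K : Type u} [CommRing R] [Field K] [IsAlgClosed K]
    [Uncountable K] (hR : #R < #K) (j₁ j₂ : R →+* K) (h₁ : Function.Injective j₁)
    (h₂ : Function.Injective j₂) : ∃ σ : K ≃+* K, ∀ r, σ (j₁ r) = j₂ r := by
  have hK : ℵ₀ < #K := aleph0_lt_mk_iff.mpr inferInstance
  have hbasis (j : R →+* K) (hj : Function.Injective j) :
      let := j.toAlgebra
      ∃ s : Set K, IsTranscendenceBasis R ((↑) : s → K) ∧ #s = #K := by
    let := j.toAlgebra
    have : FaithfulSMul R K := (faithfulSMul_iff_algebraMap_injective R K).mpr hj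
    obtain ⟨s, hs⟩ := exists_isTranscendenceBasis R K
    refine ⟨s, hs, (mk_set_le s).antisymm ?_⟩
    have := IsAlgClosed.cardinal_le_max_transcendence_basis' _ hs
    rcases le_max_iff.mp this with h | h
    · rcases le_max_iff.mp h with h | h
      · exact absurd hR h.not_gt
      · exact h
    · exact absurd hK h.not_gt
  obtain ⟨s, hs, hsK⟩ := hbasis j₁ h₁
  obtain ⟨t, ht, htK⟩ := hbasis j₂ h₂
  obtain ⟨e⟩ := Cardinal.eq.mp (hsK.trans htK.symm)
  let S₁ := @Algebra.adjoin R K _ _ j₁.toAlgebra (Set.range ((↑) : s → K))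
  let S₂ := @Algebra.adjoin R K _ _ j₂.toAlgebra (Set.range ((↑) : t → K))
  let e₁ : MvPolynomial s R ≃+* S₁ := (@AlgebraicIndependent.aevalEquiv _ _ _ _ _ _ j₁.toAlgebra
    hs.1).toRingEquiv
  let e₂ : MvPolynomial t R ≃+* S₂ := (@AlgebraicIndependent.aevalEquiv _ _ _ _ _ _ j₂.toAlgebra
    ht.1).toRingEquiv
  let E : S₁ ≃+* S₂ := e₁.symm.trans ((MvPolynomial.renameEquiv R e).toRingEquiv.trans e₂)
  have : IsAlgClosure S₁ K :=
    @IsAlgClosed.isAlgClosure_of_transcendence_basis _ _ _ _ j₁.toAlgebra _ _ _ hs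
  have : IsAlgClosure S₂ K :=
    @IsAlgClosed.isAlgClosure_of_transcendence_basis _ _ _ _ j₂.toAlgebra _ _ _ ht
  refine ⟨IsAlgClosure.equivOfEquiv K K E, fun r => ?_⟩
  have hr₁ : j₁ r = algebraMap S₁ K (e₁ (MvPolynomial.C r)) := by
    let := j₁.toAlgebra
    have := hs.1.algebraMap_aevalEquiv (MvPolynomial.C r)
    rw [MvPolynomial.aeval_C] at this
    exact this.symm
  have hr₂ : j₂ r = algebraMap S₂ K (e₂ (MvPolynomial.C r)) := by
    let := j₂.toAlgebra
    have := ht.1.algebraMap_aevalEquiv (MvPolynomial.C r)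
    rw [MvPolynomial.aeval_C] at this
    exact this.symm
  rw [hr₁, IsAlgClosure.equivOfEquiv_algebraMap, hr₂]
  simp [E]

section AlgebraicClosure

variable {K : Type*} [Field K]

/-- The set `cl K S` as a subfield. -/
def acl (S : Set K) : Subfield K :=
  (algebraicClosure (Subfield.closure S) K).toSubfield

theorem mem_acl {S : Set K} {x : K} : x ∈ acl S ↔ IsAlgebraic (Subfield.closure S) x :=
  mem_algebraicClosure_iff

theorem coe_acl (S : Set K) : (acl S : Set K) = cl K S :=
  Set.ext fun _ => mem_acl

theorem subset_acl (S : Set K) : S ⊆ acl S := fun x hx =>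
  mem_acl.mpr (isAlgebraic_algebraMap (⟨x, Subfield.subset_closure hx⟩ : Subfield.closure S))

theorem isAlgebraic_mono {L M : Subfield K} (h : L ≤ M) {x : K} (hx : IsAlgebraic L x) :
    IsAlgebraic M x :=
  let g : L →+* M := Subfield.inclusion h
  hx.ringHom_of_comp_eq g (RingHom.id K) g.injective rfl

theorem relAlgClosed_acl (S : Set K) : RelAlgClosed (acl S) := by
  intro x hx
  have hx' : IsAlgebraic (algebraicClosure (Subfield.closure S) K) x := hx
  exact mem_algebraicClosure_iff.mpr (hx'.restrictScalars (Subfield.closure S))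

theorem acl_le {S : Set K} {Z : Subfield K} (hZ : RelAlgClosed Z) (h : S ⊆ Z) : acl S ≤ Z :=
  fun x hx => hZ x (isAlgebraic_mono (Subfield.closure_le.mpr h) (mem_acl.mp hx))

theorem acl_mono {S T : Set K} (h : S ⊆ T) : acl S ≤ acl T :=
  acl_le (relAlgClosed_acl T) (h.trans (subset_acl T))

theorem relAlgClosed_comap {Z : Subfield K} (hZ : RelAlgClosed Z) (σ : K ≃+* K) :
    RelAlgClosed (Z.comap (σ : K →+* K)) := by
  intro x hx
  let g : Z.comap (σ : K →+* K) →+* Z := ((σ : K →+* K).comp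
    (Subfield.comap (σ : K →+* K) Z).subtype).codRestrict Z (fun y => y.2)
  exact hZ _ (hx.ringHom_of_comp_eq g (σ : K →+* K) g.injective rfl)

theorem map_mem_acl_image {S : Set K} {x : K} (σ : K ≃+* K) (hx : x ∈ acl S) :
    σ x ∈ acl (σ '' S) :=
  acl_le (relAlgClosed_comap (relAlgClosed_acl (σ '' S)) σ)
    (fun _ hy => subset_acl _ (Set.mem_image_of_mem σ hy)) hx

theorem map_mem_acl_image_iff {S : Set K} {x : K} (σ : K ≃+* K) :
    σ x ∈ acl (σ '' S) ↔ x ∈ acl S := by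
  refine ⟨fun h => ?_, map_mem_acl_image σ⟩
  have := map_mem_acl_image σ.symm h
  rwa [σ.symm_apply_apply, Set.image_image, Set.image_congr (g := id), Set.image_id] at this
  simp

theorem mem_acl_union {Z : Subfield K} {S : Set K} {x : K} :
    x ∈ acl (Z ∪ S) ↔ IsAlgebraic (Algebra.adjoin Z S) x := by
  rw [← IntermediateField.isAlgebraic_adjoin_iff, mem_acl]
  have : Subfield.closure ((Z : Set K) ∪ S) = (IntermediateField.adjoin Z S).toSubfield := by
    change _ = Subfield.closure _
    rw [show Set.range (algebraMap Z K) = Z from Subtype.range_coe]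
  rw [this]
  rfl

theorem isAlgClosed_of_relAlgClosed [IsAlgClosed K] {Z : Subfield K} (hZ : RelAlgClosed Z) :
    IsAlgClosed Z := by
  refine IsAlgClosed.of_exists_root _ fun p _ hp => ?_
  obtain ⟨x, hx⟩ := IsAlgClosed.exists_aeval_eq_zero K p hp.degree_pos.ne'
  have hxZ : x ∈ Z := hZ x ⟨p, hp.ne_zero, hx⟩
  refine ⟨⟨x, hxZ⟩, ?_⟩
  have : Polynomial.aeval (algebraMap Z K ⟨x, hxZ⟩) p = 0 := hx
  rw [Polynomial.aeval_algebraMap_apply] at this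
  exact (FaithfulSMul.algebraMap_eq_zero_iff Z K).mp this

theorem mk_acl_lt [Uncountable K] {S : Set K} (hS : #S < #K) : #(acl S) < #K := by
  have hK : ℵ₀ < #K := aleph0_lt_mk_iff.mpr inferInstance
  have : #(algebraicClosure (Subfield.closure S) K) ≤ max #(Subfield.closure S) ℵ₀ :=
    Algebra.IsAlgebraic.cardinalMk_le_max _ _
  refine this.trans_lt (max_lt ?_ hK)
  exact (Subfield.cardinalMk_closure_le_max S).trans_lt (max_lt hS hK)

theorem mk_union_lt {K : Type*} [Uncountable K] {S T : Set K} (hS : #S < #K) (hT : #T < #K) :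
    #(S ∪ T : Set K) < #K := by
  have hK : ℵ₀ < #K := aleph0_lt_mk_iff.mpr inferInstance
  exact (mk_union_le S T).trans_lt (add_lt_of_lt hK.le hS hT)

theorem mk_lt_of_countable {K : Type*} [Uncountable K] {S : Set K} (hS : S.Countable) : #S < #K :=
  hS.le_aleph0.trans_lt (aleph0_lt_mk_iff.mpr inferInstance)

theorem SmallTrdeg.mk_lt [Uncountable K] {X : Subfield K} (h : SmallTrdeg X) : #X < #K := by
  have hK : ℵ₀ < #K := aleph0_lt_mk_iff.mpr inferInstance
  obtain ⟨s, hs, hsK⟩ := h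
  let T : Set K := (↑) '' s
  have hT : #T < #K := mk_image_le.trans_lt hsK
  refine lt_of_le_of_lt (mk_le_mk_of_subset (?_ : (X : Set K) ⊆ acl T)) (mk_acl_lt hT)
  intro x hx
  have halg : Algebra.IsAlgebraic (Algebra.adjoin (⊥ : Subfield X) (Set.range ((↑) : s → X))) X :=
    hs.isAlgebraic
  have hx' := halg.isAlgebraic ⟨x, hx⟩
  have hle : ∀ y ∈ Algebra.adjoin (⊥ : Subfield X) (Set.range ((↑) : s → X)),
      (y : K) ∈ Subfield.closure T := by
    intro y hy
    induction hy using Algebra.adjoin_induction with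
    | mem y hy =>
      obtain ⟨z, rfl⟩ := hy
      exact Subfield.subset_closure ⟨z, z.2, rfl⟩
    | algebraMap r =>
      have : (⊥ : Subfield X) ≤ (Subfield.closure T).comap X.subtype := bot_le
      exact this r.2
    | add y z _ _ hy hz => exact add_mem hy hz
    | mul y z _ _ hy hz => exact mul_mem hy hz
  let g : Algebra.adjoin (⊥ : Subfield X) (Set.range ((↑) : s → X)) →+* Subfield.closure T :=
    (X.subtype.comp (algebraMap _ X)).codRestrict (Subfield.closure T) (fun y => hle y y.2)
  refine mem_acl.mpr (hx'.ringHom_of_comp_eq g X.subtype ?_ rfl)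
  intro y z hyz
  exact Subtype.ext (Subtype.ext (Subtype.ext_iff.mp hyz :))

end AlgebraicClosure

/-- Algebraicity of a subalgebra over a generating family may be tested in the ambient ring. -/
theorem Subalgebra.isAlgebraic_adjoin_range_of_val {k L κ : Type*} [CommRing k] [CommRing L]
    [Algebra k L] (B : Subalgebra k L) (c : κ → B)
    (h : ∀ x : B, IsAlgebraic (Algebra.adjoin k (Set.range fun i => (c i : L))) (x : L)) :
    Algebra.IsAlgebraic (Algebra.adjoin k (Set.range c)) B := by
  have hmap : (Algebra.adjoin k (Set.range c)).map B.val =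
      Algebra.adjoin k (Set.range fun i => (c i : L)) := by
    rw [AlgHom.map_adjoin, ← Set.range_comp]; rfl
  let g : Algebra.adjoin k (Set.range c) →+* Algebra.adjoin k (Set.range fun i => (c i : L)) :=
    (B.val.toRingHom.comp (algebraMap (Algebra.adjoin k (Set.range c)) B)).codRestrict
      (Algebra.adjoin k (Set.range fun i => (c i : L)))
      (fun x => hmap ▸ ⟨x, x.2, rfl⟩)
  refine ⟨fun x => (h x).of_ringHom_of_comp_eq g B.val ?_ Subtype.val_injective rfl⟩
  rintro ⟨y, hy⟩
  obtain ⟨z, hz, hzy⟩ : y ∈ (Algebra.adjoin k (Set.range c)).map B.val := hmap ▸ hy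
  exact ⟨⟨z, hz⟩, Subtype.ext hzy⟩

/-- If `B` is free from `A` over `k`, both under the inclusion and under `G : B →ₐ[k] K`, then
the inclusion of `A` and `G` extend to a common automorphism of `K`. -/
theorem exists_ringEquiv_of_subalgebra {k : Type*} {K : Type u} [Field k] [IsAlgClosed k] [Field K]
    [Algebra k K] [IsAlgClosed K] [Uncountable K] (A B : Subalgebra k K) {κ κ' : Type*}
    (c : κ → B) (c' : κ' → B)
    (hc : Algebra.IsAlgebraic (Algebra.adjoin k (Set.range c)) B)
    (hc' : Algebra.IsAlgebraic (Algebra.adjoin k (Set.range c')) B)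
    (G : B →ₐ[k] K) (hind₁ : AlgebraicIndependent A (B.val ∘ c))
    (hind₂ : AlgebraicIndependent A (G ∘ c')) (hsmall : #(A ⊔ B : Subalgebra k K) < #K) :
    ∃ σ : K ≃+* K, (∀ x ∈ A, σ x = x) ∧ ∀ x : B, σ x = G x := by
  have hj₁ := injective_tensorProduct_lift (A := A) B.val c hc hind₁
  have hj₂ := injective_tensorProduct_lift (A := A) G c' hc' hind₂
  set j₁ := Algebra.TensorProduct.lift (Algebra.ofId A K) B.val (fun _ _ => .all _ _) with hj₁'
  set j₂ := Algebra.TensorProduct.lift (Algebra.ofId A K) G (fun _ _ => .all _ _) with hj₂'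
  have hrange (t : A ⊗[k] B) : j₁ t ∈ A ⊔ B := by
    induction t with
    | zero => rw [map_zero]; exact zero_mem _
    | add x y hx hy => rw [map_add]; exact add_mem hx hy
    | tmul x y =>
      have : j₁ (x ⊗ₜ y) = x * y := Algebra.TensorProduct.lift_tmul _ _ _ _ _
      rw [this]
      exact mul_mem (le_sup_left (a := A) x.2) (le_sup_right (b := B) y.2)
  have hT : #(A ⊗[k] B) < #K := by
    refine lt_of_le_of_lt (mk_le_of_injective (f := fun t => (⟨j₁ t, hrange t⟩ :
      (A ⊔ B : Subalgebra k K))) ?_) hsmall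
    intro s t hst
    exact hj₁ (congrArg Subtype.val hst)
  obtain ⟨σ, hσ⟩ := exists_ringEquiv_comp_eq hT (j₁ : A ⊗[k] B →+* K) (j₂ : A ⊗[k] B →+* K)
    hj₁ hj₂
  refine ⟨σ, fun x hx => ?_, fun x => ?_⟩
  · have := hσ (⟨x, hx⟩ ⊗ₜ 1)
    simpa [hj₁', hj₂', Algebra.ofId_apply] using this
  · have := hσ (1 ⊗ₜ x)
    simpa [hj₁', hj₂'] using this

/-- The elements algebraic over `Z` and `S`, as a `Z`-subalgebra. -/
def aclAlg {K : Type*} [Field K] (Z : Subfield K) (S : Set K) : Subalgebra Z K :=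
  (Subalgebra.algebraicClosure (Algebra.adjoin Z S) K).restrictScalars Z

theorem mem_aclAlg {K : Type*} [Field K] {Z : Subfield K} {S : Set K} {x : K} :
    x ∈ aclAlg Z S ↔ x ∈ acl (Z ∪ S) := by
  rw [mem_acl_union]; rfl

theorem AlgebraicIndependent.aclAlg {K : Type*} [Field K] {Z : Subfield K} {ι κ : Type*}
    {b : ι → K} {c : κ → K} (h : AlgebraicIndependent Z (Sum.elim c b)) :
    AlgebraicIndependent (aclAlg Z (Set.range b)) c :=
  (AlgebraicIndependent.sumElim_iff.mp h).2.subalgebraAlgebraicClosure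

/-- Two automorphisms of `K` over a small algebraically closed field `Z`, one of them the
identity, can be amalgamated on the algebraic closures of independent families. -/
theorem exists_amalgam {K : Type u} [Field K] [IsAlgClosed K] [Uncountable K] {Z : Subfield K}
    (hZ : RelAlgClosed Z) {ι κ κ' : Type*} (b : ι → K) (c : κ → K) (c' : κ' → K)
    (hsmall : #(acl (Z ∪ (Set.range b ∪ Set.range c))) < #K)
    (hbc : AlgebraicIndependent Z (Sum.elim c b))
    (hc' : acl (Z ∪ Set.range c') = acl (Z ∪ Set.range c))
    (G : K ≃+* K) (hG : ∀ z ∈ Z, G z = z)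
    (hGbc : AlgebraicIndependent Z (Sum.elim (G ∘ c') b)) :
    ∃ σ : K ≃+* K, (∀ x ∈ acl (Z ∪ Set.range b), σ x = x) ∧
      ∀ x ∈ acl (Z ∪ Set.range c), σ x = G x := by
  have := isAlgClosed_of_relAlgClosed hZ
  let B := aclAlg Z (Set.range c)
  let Gb : B →ₐ[Z] K :=
    { toRingHom := (G : K →+* K).comp B.val.toRingHom, commutes' := fun z => hG z z.2 }
  let cB : κ → B := fun i => ⟨c i, mem_aclAlg.mpr (subset_acl _ (.inr ⟨i, rfl⟩))⟩
  let cB' : κ' → B := fun i => ⟨c' i, mem_aclAlg.mpr (hc' ▸ subset_acl _ (.inr ⟨i, rfl⟩))⟩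
  obtain ⟨σ, h₁, h₂⟩ := exists_ringEquiv_of_subalgebra (aclAlg Z (Set.range b)) B cB cB'
    (B.isAlgebraic_adjoin_range_of_val cB fun x => mem_acl_union.mp (mem_aclAlg.mp x.2))
    (B.isAlgebraic_adjoin_range_of_val cB' fun x =>
      mem_acl_union.mp (hc' ▸ mem_aclAlg.mp x.2)) Gb hbc.aclAlg hGbc.aclAlg (by
    refine (mk_le_mk_of_subset fun x hx => ?_).trans_lt hsmall
    have hle : aclAlg Z (Set.range b) ⊔ B ≤ aclAlg Z (Set.range b ∪ Set.range c) := by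
      refine sup_le (fun y hy => ?_) (fun y hy => ?_)
      · rw [mem_aclAlg] at hy ⊢
        exact acl_mono (Set.union_subset_union_right _ Set.subset_union_left) hy
      · rw [mem_aclAlg] at hy ⊢
        exact acl_mono (Set.union_subset_union_right _ Set.subset_union_right) hy
    exact mem_aclAlg.mp (hle hx))
  exact ⟨σ, fun x hx => h₁ x (mem_aclAlg.mpr hx), fun x hx => h₂ ⟨x, mem_aclAlg.mpr hx⟩⟩

section Automorphism

variable {K : Type u} [Field K]

/-- The automorphisms of `K` mapping the subfield `Z` onto itself. -/
def stab (Z : Subfield K) : Subgroup (RingAut K) where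
  carrier := {σ | ∀ x, σ x ∈ Z ↔ x ∈ Z}
  mul_mem' hσ hρ x := (hσ _).trans (hρ x)
  one_mem' _ := Iff.rfl
  inv_mem' {σ} hσ x := by
    rw [← hσ (σ⁻¹ x)]
    exact iff_of_eq (congrArg (· ∈ Z) (σ.apply_symm_apply x).symm).symm

theorem mem_stab_iff_map {Z : Subfield K} {σ : RingAut K} :
    σ ∈ stab Z ↔ Z.map (σ : K →+* K) = Z := by
  constructor
  · intro h
    ext x
    rw [Subfield.mem_map]
    refine ⟨?_, fun hx => ⟨σ⁻¹ x, ((stab Z).inv_mem h x).mpr hx, σ.apply_symm_apply x⟩⟩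
    rintro ⟨y, hy, rfl⟩
    exact (h y).mpr hy
  · intro h x
    have : σ x ∈ Z.map (σ : K →+* K) ↔ x ∈ Z := by
      rw [Subfield.mem_map]
      exact ⟨fun ⟨y, hy, hyx⟩ => σ.injective hyx ▸ hy, fun hx => ⟨x, hx, rfl⟩⟩
    rwa [h] at this

theorem mem_stab_of_eqOn {Z : Subfield K} {σ ρ : RingAut K} (hσ : σ ∈ stab Z)
    (h : ∀ x ∈ Z, ρ x = σ x) : ρ ∈ stab Z := by
  intro x
  refine ⟨fun hx => ?_, fun hx => h x hx ▸ (hσ x).mpr hx⟩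
  have hy : σ⁻¹ (ρ x) ∈ Z := ((stab Z).inv_mem hσ _).mpr hx
  have : ρ (σ⁻¹ (ρ x)) = ρ x := (h _ hy).trans (σ.apply_symm_apply _)
  exact ρ.injective this ▸ hy

theorem inv_eqOn {Z : Subfield K} {σ ρ : RingAut K} (hσ : σ ∈ stab Z)
    (h : ∀ x ∈ Z, ρ x = σ x) {x : K} (hx : x ∈ Z) : ρ⁻¹ x = σ⁻¹ x := by
  have hy : σ⁻¹ x ∈ Z := ((stab Z).inv_mem hσ _).mpr hx
  exact ρ.symm_apply_eq.mpr ((h _ hy).trans (σ.apply_symm_apply x)).symm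

theorem map_mem_acl_union_iff {Z : Subfield K} {σ : RingAut K} (hσ : σ ∈ stab Z) {S : Set K}
    {x : K} : σ x ∈ acl (Z ∪ σ '' S) ↔ x ∈ acl (Z ∪ S) := by
  have : σ '' (Z : Set K) = Z := congrArg SetLike.coe (mem_stab_iff_map.mp hσ)
  rw [← map_mem_acl_image_iff (x := x) σ, Set.image_union, this]

theorem AlgebraicIndependent.comp_stab {Z : Subfield K} {σ : RingAut K} (hσ : σ ∈ stab Z)
    {ι : Type*} {v : ι → K} (hv : AlgebraicIndependent Z v) :
    AlgebraicIndependent Z (σ ∘ v) := by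
  let e : Z →+* Z := ((σ : K →+* K).comp Z.subtype).codRestrict Z fun z => (hσ z).mpr z.2
  refine hv.ringHom_of_comp_eq e (σ : K →+* K) (fun z => ?_) (σ : K →+* K).injective rfl
  exact ⟨⟨σ⁻¹ z, ((stab Z).inv_mem hσ _).mpr z.2⟩, Subtype.ext (σ.apply_symm_apply _)⟩

/-- An automorphism stabilising a small subfield may be extended from there with prescribed
values on an independent family. -/
theorem exists_ringAut_extend [IsAlgClosed K] [Uncountable K] {Z : Subfield K} (hZ : #Z < #K)
    {F₀ : RingAut K} (hF₀ : F₀ ∈ stab Z) {ι : Type u} [Countable ι] {p y : ι → K}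
    (hp : AlgebraicIndependent Z p) (hy : AlgebraicIndependent Z y) :
    ∃ F : RingAut K, (∀ z ∈ Z, F z = F₀ z) ∧ ∀ i, F (p i) = y i := by
  have hK : ℵ₀ < #K := aleph0_lt_mk_iff.mpr inferInstance
  have hcard : #(MvPolynomial ι Z) < #K :=
    MvPolynomial.cardinalMk_le_max.trans_lt
      (max_lt (max_lt hZ (mk_le_aleph0.trans_lt hK)) hK)
  have hy' := hy.comp_stab ((stab Z).inv_mem hF₀)
  obtain ⟨F, hF⟩ := exists_ringEquiv_comp_eq hcard (MvPolynomial.aeval p).toRingHom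
    (MvPolynomial.aeval (fun i => F₀⁻¹ (y i))).toRingHom hp hy'
  refine ⟨F₀ * F, fun z hz => ?_, fun i => ?_⟩
  · have : F z = z := by
      have h := hF (MvPolynomial.C ⟨z, hz⟩)
      simp only [AlgHom.toRingHom_eq_coe, RingHom.coe_coe, MvPolynomial.aeval_C] at h
      exact h
    exact congrArg F₀ this
  · have : F (p i) = F₀⁻¹ (y i) := by
      have h := hF (MvPolynomial.X i)
      simp only [AlgHom.toRingHom_eq_coe, RingHom.coe_coe, MvPolynomial.aeval_X] at h
      exact h
    exact (congrArg F₀ this).trans (F₀.apply_symm_apply _)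

theorem algebraicIndependent_nat_of_notMem_acl {Z : Subfield K} {v : ℕ → K}
    (hv : ∀ n, v n ∉ acl (Z ∪ v '' Set.Iio n)) : AlgebraicIndependent Z v := by
  have key (n : ℕ) : AlgebraicIndepOn Z v (Set.Iio n) := by
    induction n with
    | zero =>
      have : IsEmpty (Set.Iio 0) := ⟨fun x => absurd x.2 (Nat.not_lt_zero _)⟩
      exact algebraicIndependent_empty_type
    | succ n ih =>
      have : Set.Iio (n + 1) = insert n (Set.Iio n) := by
        ext m; simp only [Set.mem_Iio, Set.mem_insert_iff]; omega
      rw [this]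
      exact ih.insert fun h => hv n (mem_acl_union.mpr h)
  refine algebraicIndependent_of_finite_type fun t ht => ?_
  obtain ⟨n, hn⟩ := ht.bddAbove
  exact AlgebraicIndepOn.mono (key (n + 1)) fun m hm => Nat.lt_succ_of_le (hn hm)

/-- Over any small subfield, an unbounded automorphism `τ` has a sequence `b` such that `b`
and `τ⁻¹ b` are jointly independent. -/
theorem exists_independent_sequence [Uncountable K] {τ : RingAut K} (hτ : ¬ IsBounded τ)
    {Z : Subfield K} (hZ : #Z < #K) :
    ∃ b : ℕ → K, AlgebraicIndependent Z (Sum.elim (fun n => τ⁻¹ (b n)) b) := by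
  have hstep (A : {A : Set K // #A < #K}) :
      ∃ β : K, β ∉ acl A.1 ∧ τ β ∉ acl (A.1 ∪ {β}) := by
    by_contra! h
    refine hτ ⟨A, A.2, fun b hb => ?_⟩
    rw [← coe_acl] at hb ⊢
    exact h b hb
  choose β hβ hτβ using hstep
  let next (A : {A : Set K // #A < #K}) : {A : Set K // #A < #K} :=
    ⟨A.1 ∪ {β A, τ (β A)}, mk_union_lt A.2 (mk_lt_of_countable (Set.to_countable _))⟩
  let S (n : ℕ) : {A : Set K // #A < #K} := next^[n] ⟨Z, hZ⟩
  have hS (n : ℕ) : (S (n + 1) : Set K) = (S n : Set K) ∪ {β (S n), τ (β (S n))} :=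
    congrArg Subtype.val (Function.iterate_succ_apply' next n _)
  have hmono : Monotone fun n => (S n : Set K) :=
    monotone_nat_of_le_succ fun n => by rw [hS]; exact Set.subset_union_left
  let v (m : ℕ) : K := if m % 2 = 0 then β (S (m / 2)) else τ (β (S (m / 2)))
  have hvmem (m : ℕ) : v m ∈ (S (m / 2 + 1) : Set K) := by
    rw [hS]
    by_cases h : m % 2 = 0 <;> simp [v, h]
  have hv : AlgebraicIndependent Z v := by
    refine algebraicIndependent_nat_of_notMem_acl fun n hn => ?_
    by_cases h : n % 2 = 0
    · have hvn : v n = β (S (n / 2)) := if_pos h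
      rw [hvn] at hn
      refine hβ _ (acl_mono (Set.union_subset (hmono (Nat.zero_le _)) ?_) hn)
      rintro _ ⟨m, hm, rfl⟩
      have hm' : m < n := hm
      exact hmono (by omega) (hvmem m)
    · have hvn : v n = τ (β (S (n / 2))) := if_neg h
      rw [hvn] at hn
      refine hτβ _ (acl_mono (Set.union_subset ((hmono (Nat.zero_le _)).trans
        Set.subset_union_left) ?_) hn)
      rintro _ ⟨m, hm, rfl⟩
      have hm' : m < n := hm
      rcases lt_or_ge (m / 2) (n / 2) with hlt | hge
      · exact .inl (hmono hlt (hvmem m))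
      · have hm2 : m % 2 = 0 := by omega
        have hmn : m / 2 = n / 2 := by omega
        right
        simp [v, hm2, hmn]
  have hv₀ (n : ℕ) : v (2 * n) = β (S n) := by
    simp only [v]
    rw [if_pos (by omega), Nat.mul_div_cancel_left n two_pos]
  have hv₁ (n : ℕ) : v (2 * n + 1) = τ (β (S n)) := by
    simp only [v]
    rw [if_neg (by omega), show (2 * n + 1) / 2 = n by omega]
  refine ⟨fun n => τ (β (S n)), ?_⟩
  convert hv.comp (Sum.elim (fun n => 2 * n) fun n => 2 * n + 1) ?_ using 1
  · funext i
    rcases i with n | n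
    · exact (τ.symm_apply_apply _).trans (hv₀ n).symm
    · exact (hv₁ n).symm
  · rintro (m | m) (n | n) h <;> simp at h ⊢ <;> omega

end Automorphism

section Commutator

variable {K : Type u} [Field K]

theorem exists_independent_acl_eq (Z : Subfield K) {I S : Set K} (hI : I ⊆ S)
    (hind : AlgebraicIndependent Z ((↑) : I → K)) :
    ∃ s, I ⊆ s ∧ s ⊆ S ∧ AlgebraicIndependent Z ((↑) : s → K) ∧ acl (Z ∪ s) = acl (Z ∪ S) := by
  have hI' : (AlgebraicIndependent.matroid Z K).Indep I :=
    AlgebraicIndependent.matroid_indep_iff.mpr hind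
  obtain ⟨s, hs, hIs⟩ := hI'.subset_isBasis_of_subset hI
  obtain ⟨h₁, h₂, h₃⟩ := AlgebraicIndependent.matroid_isBasis_iff.mp hs
  refine ⟨s, hIs, h₂, h₁, le_antisymm (acl_mono (Set.union_subset_union_right _ h₂)) ?_⟩
  refine acl_le (relAlgClosed_acl _) (Set.union_subset ?_ fun x hx => ?_)
  · exact Set.subset_union_left.trans (subset_acl _)
  · exact mem_acl_union.mpr (h₃ x hx)

/-- The product of commutators `f τ g τ⁻¹ g⁻¹ f⁻¹`, as an element of the automorphism group. -/
def psiAut (τ f g : RingAut K) : RingAut K := f * τ * g * τ⁻¹ * g⁻¹ * f⁻¹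

theorem psiAut_apply (τ f g : RingAut K) (x : K) :
    psiAut τ f g x = f (τ (g (τ⁻¹ (g⁻¹ (f⁻¹ x))))) := rfl

/-- If `φ = Ψ(f, g)` on a small closed subfield `Z`, and `W = cl (Z ∪ S)` is `φ`-invariant with
`S` countable, then `f` and `g` may be changed outside `Z` so that `φ = Ψ(f, g)` on `W`. -/
theorem exists_psiAut_eqOn [IsAlgClosed K] [Uncountable K] {Z : Subfield K} (hZ : RelAlgClosed Z)
    (hcard : #Z < #K) {τ f g φ : RingAut K} (hτ : ¬ IsBounded τ) (hτZ : τ ∈ stab Z)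
    (hf : f ∈ stab Z) (hg : g ∈ stab Z) (hφ : ∀ z ∈ Z, φ z = psiAut τ f g z) {S : Set K}
    (hS : S.Countable) (hφS : φ ∈ stab (acl (Z ∪ S))) :
    ∃ f' g' : RingAut K, (∀ z ∈ Z, f' z = f z) ∧ (∀ z ∈ Z, g' z = g z) ∧
      ∀ w ∈ acl (Z ∪ S), psiAut τ f' g' w = φ w := by
  obtain ⟨s, -, hsS, hs, hsW⟩ := exists_independent_acl_eq Z (Set.empty_subset S)
    algebraicIndependent_empty_type
  have : Countable s := (hS.mono hsS).to_subtype
  obtain ⟨e, he⟩ := exists_injective_nat s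
  obtain ⟨b₀, hb₀⟩ := exists_independent_sequence hτ hcard
  let b : s → K := fun i => b₀ (e i)
  have hb : AlgebraicIndependent Z (Sum.elim (fun i => τ⁻¹ (b i)) b) := by
    convert hb₀.comp (Sum.map e e) (he.sumMap he) using 1
    funext i
    rcases i with i | i <;> rfl
  have hb' : AlgebraicIndependent Z b := hb.comp Sum.inr Sum.inr_injective
  obtain ⟨f', hf'Z, hf'b⟩ := exists_ringAut_extend hcard hf hb' hs
  obtain ⟨G₁, hG₁Z, hG₁b⟩ := exists_ringAut_extend hcard hg hb' hb'
  have hf' := mem_stab_of_eqOn hf hf'Z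
  have hG₁ := mem_stab_of_eqOn hg hG₁Z
  set V := acl (Z ∪ Set.range b) with hV
  have hZV : ∀ z ∈ Z, z ∈ V := fun z hz => subset_acl _ (.inl hz)
  have hf'V (x : K) : f' x ∈ acl (Z ∪ S) ↔ x ∈ V := by
    have : f' '' Set.range b = s := by
      rw [← Set.range_comp, show f' ∘ b = ((↑) : s → K) from funext hf'b, Subtype.range_coe]
    rw [hV, ← map_mem_acl_union_iff (x := x) hf', this, hsW]
  have hG₁V : G₁ ∈ stab V := fun x => by
    rw [hV]
    nth_rw 2 [← map_mem_acl_union_iff hG₁]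
    rw [← Set.range_comp, show G₁ ∘ b = b from funext hG₁b]
  set χ : RingAut K := f'⁻¹ * φ * f' with hχ
  have hχV : χ ∈ stab V := fun x => by
    have : f' (χ x) = φ (f' x) := f'.apply_symm_apply _
    rw [← hf'V, this, hφS, hf'V]
  have hχZ (z : K) (hz : z ∈ Z) : χ z = τ (g (τ⁻¹ (g⁻¹ z))) := by
    have h₁ : f (τ (g (τ⁻¹ (g⁻¹ z)))) = φ (f' z) := by
      rw [hf'Z z hz, hφ _ ((hf z).mpr hz), psiAut_apply]
      exact congrArg (fun t => f (τ (g (τ⁻¹ (g⁻¹ t))))) (f.symm_apply_apply z).symm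
    have h₂ : τ (g (τ⁻¹ (g⁻¹ z))) ∈ Z := by
      rw [hτZ, hg, (stab Z).inv_mem hτZ, (stab Z).inv_mem hg]
      exact hz
    rw [← hf'Z _ h₂] at h₁
    exact f'.symm_apply_eq.mpr h₁.symm
  set G₂ : RingAut K := τ⁻¹ * χ * G₁ * τ with hG₂
  have hG₂Z (z : K) (hz : z ∈ Z) : G₂ z = g z := by
    have h₁ : G₁ (τ z) = g (τ z) := hG₁Z _ ((hτZ z).mpr hz)
    have h₂ : χ (g (τ z)) = τ (g z) := by
      rw [hχZ _ ((hg _).mpr ((hτZ z).mpr hz))]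
      congr 2
      exact τ.symm_apply_eq.mpr (g.symm_apply_apply _)
    exact τ.symm_apply_eq.mpr ((congrArg χ h₁).trans h₂)
  have hG₂s := mem_stab_of_eqOn hg hG₂Z
  set U := acl (Z ∪ Set.range fun i => τ⁻¹ (b i)) with hU
  have hτU (x : K) : τ x ∈ V ↔ x ∈ U := by
    have : τ '' Set.range (fun i => τ⁻¹ (b i)) = Set.range b := by
      rw [← Set.range_comp]
      exact congrArg Set.range (funext fun i => τ.apply_symm_apply _)
    rw [hU, ← map_mem_acl_union_iff (x := x) hτZ, this]
  have hG₂U : G₂ ∈ stab U := fun x => by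
    have : τ (G₂ x) = χ (G₁ (τ x)) := τ.apply_symm_apply _
    rw [← hτU, this, hχV, hG₁V, hτU]
  obtain ⟨σ, hσV, hσU⟩ := exists_amalgam hZ b (fun i => τ⁻¹ (b i)) (fun i => G₂⁻¹ (τ⁻¹ (b i)))
    (mk_acl_lt (mk_union_lt hcard (mk_lt_of_countable
      ((Set.countable_range _).union (Set.countable_range _))))) hb (by
      ext x
      rw [← map_mem_acl_union_iff hG₂s, ← Set.range_comp]
      rw [show (G₂ ∘ fun i => G₂⁻¹ (τ⁻¹ (b i))) = fun i => τ⁻¹ (b i) from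
        funext fun i => G₂.apply_symm_apply _]
      exact hG₂U x) (G₁⁻¹ * G₂ : RingAut K) (fun z hz => by
      have : G₂ z = G₁ z := (hG₂Z z hz).trans (hG₁Z z hz).symm
      exact G₁.symm_apply_eq.mpr this) (by
      convert hb.comp_stab ((stab Z).inv_mem hG₁) using 1
      funext i
      rcases i with i | i
      · exact congrArg (G₁⁻¹ : RingAut K) (G₂.apply_symm_apply _)
      · exact (G₁.symm_apply_eq.mpr (hG₁b i).symm).symm)
  have hgV (x : K) (hx : x ∈ V) : (G₁ * σ : RingAut K) x = G₁ x := congrArg G₁ (hσV x hx)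
  have hgU (x : K) (hx : x ∈ U) : (G₁ * σ : RingAut K) x = G₂ x :=
    (congrArg G₁ (hσU x hx)).trans (G₁.apply_symm_apply _)
  refine ⟨f', G₁ * σ, hf'Z, fun z hz => (hgV z (hZV z hz)).trans (hG₁Z z hz), fun w hw => ?_⟩
  obtain ⟨v, rfl⟩ := f'.surjective w
  have hv : v ∈ V := (hf'V v).mp hw
  have hv' : G₁⁻¹ v ∈ V := ((stab V).inv_mem hG₁V v).mpr hv
  have h₁ : f'⁻¹ (f' v) = v := f'.symm_apply_apply v
  have h₂ : τ (τ⁻¹ (G₁⁻¹ v)) = G₁⁻¹ v := τ.apply_symm_apply _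
  rw [psiAut_apply, h₁, inv_eqOn hG₁V hgV hv, hgU _ ((hτU _).mp (h₂.symm ▸ hv' :))]
  have h₃ : τ (G₂ (τ⁻¹ (G₁⁻¹ v))) = χ v := by
    refine (τ.apply_symm_apply _).trans (congrArg χ ?_)
    exact (congrArg G₁ h₂).trans (G₁.apply_symm_apply v)
  rw [h₃]
  exact f'.apply_symm_apply _

end Commutator

section Chain

variable {K : Type u} [Field K]

theorem psiAut_mem_stab {U : Subfield K} {τ f g : RingAut K} (hτ : τ ∈ stab U) (hf : f ∈ stab U)
    (hg : g ∈ stab U) : psiAut τ f g ∈ stab U :=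
  mul_mem (mul_mem (mul_mem (mul_mem (mul_mem hf hτ) hg) (inv_mem hτ)) (inv_mem hg)) (inv_mem hf)

theorem psiAut_congr {U : Subfield K} {τ f g f' g' : RingAut K} (hτ : τ ∈ stab U)
    (hf : f ∈ stab U) (hg : g ∈ stab U) (hf' : ∀ x ∈ U, f' x = f x) (hg' : ∀ x ∈ U, g' x = g x)
    {x : K} (hx : x ∈ U) : psiAut τ f' g' x = psiAut τ f g x := by
  have h₁ : f⁻¹ x ∈ U := (inv_mem hf _).mpr hx
  have h₂ : g⁻¹ (f⁻¹ x) ∈ U := (inv_mem hg _).mpr h₁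
  have h₃ : τ⁻¹ (g⁻¹ (f⁻¹ x)) ∈ U := (inv_mem hτ _).mpr h₂
  have h₄ : τ (g (τ⁻¹ (g⁻¹ (f⁻¹ x)))) ∈ U := (hτ _).mpr ((hg _).mpr h₃)
  rw [psiAut_apply, psiAut_apply, inv_eqOn hf hf' hx, inv_eqOn hg hg' h₁, hg' _ h₃, hf' _ h₄]

theorem mem_stab_acl_of_image {Z : Subfield K} {σ : RingAut K} (hσ : σ ∈ stab Z) {S : Set K}
    (h : σ '' S = S) : σ ∈ stab (acl (Z ∪ S)) := fun x => by
  rw [← map_mem_acl_union_iff (x := x) hσ, h]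

/-- A countable set may be enlarged to a countable set invariant under countably many
automorphisms. -/
theorem exists_countable_invariant (Γ : Set (RingAut K)) (hΓ : Γ.Countable) {S : Set K}
    (hS : S.Countable) : ∃ T, S ⊆ T ∧ T.Countable ∧ ∀ σ ∈ Γ, σ '' T = T := by
  let next (T : Set K) : Set K := T ∪ ⋃ σ ∈ Γ, (σ '' T ∪ (σ⁻¹ : RingAut K) '' T)
  let T (n : ℕ) : Set K := next^[n] S
  have hT (n : ℕ) : T (n + 1) = next (T n) := Function.iterate_succ_apply' next n _
  refine ⟨⋃ n, T n, Set.subset_iUnion T 0, Set.countable_iUnion fun n => ?_, fun σ hσ => ?_⟩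
  · induction n with
    | zero => exact hS
    | succ n ih =>
      rw [hT]
      exact ih.union (hΓ.biUnion fun σ _ => (ih.image _).union (ih.image _))
  · have h₁ : ∀ x ∈ ⋃ n, T n, σ x ∈ ⋃ n, T n := by
      intro x hx
      obtain ⟨n, hn⟩ := Set.mem_iUnion.mp hx
      refine Set.mem_iUnion.mpr ⟨n + 1, ?_⟩
      rw [hT]
      exact .inr (Set.mem_biUnion hσ (.inl ⟨x, hn, rfl⟩))
    have h₂ : ∀ x ∈ ⋃ n, T n, σ⁻¹ x ∈ ⋃ n, T n := by
      intro x hx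
      obtain ⟨n, hn⟩ := Set.mem_iUnion.mp hx
      refine Set.mem_iUnion.mpr ⟨n + 1, ?_⟩
      rw [hT]
      exact .inr (Set.mem_biUnion hσ (.inr ⟨x, hn, rfl⟩))
    refine Set.Subset.antisymm ?_ fun x hx => ⟨σ⁻¹ x, h₂ x hx, σ.apply_symm_apply x⟩
    rintro _ ⟨x, hx, rfl⟩
    exact h₁ x hx

theorem mem_iSup_nat {U : ℕ → Subfield K} (hU : Monotone U) {x : K} :
    x ∈ ⨆ n, U n ↔ ∃ n, x ∈ U n :=
  Subfield.mem_iSup_of_directed hU.directed_le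

theorem relAlgClosed_iSup {U : ℕ → Subfield K} (hU : Monotone U)
    (hcl : ∀ n, RelAlgClosed (U n)) : RelAlgClosed (⨆ n, U n) := by
  rintro x ⟨p, hp, hpx⟩
  have hcoeff (i : ℕ) : ∃ n, (p.coeff i : K) ∈ U n := (mem_iSup_nat hU).mp (p.coeff i).2
  choose n hn using hcoeff
  let N := p.support.sup n
  have hN (i : ℕ) : (p.coeff i : K) ∈ U N := by
    by_cases hi : i ∈ p.support
    · exact hU (Finset.le_sup hi) (hn i)
    · rw [Polynomial.notMem_support_iff.mp hi]
      exact zero_mem _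
  obtain ⟨q, hq⟩ : p.map (⨆ n, U n).subtype ∈ Polynomial.lifts (U N).subtype := by
    rw [Polynomial.lifts_iff_coeff_lifts]
    intro i
    rw [Polynomial.coeff_map]
    exact ⟨⟨_, hN i⟩, rfl⟩
  have hq' : q.map (U N).subtype = p.map (⨆ n, U n).subtype := hq
  refine (mem_iSup_nat hU).mpr ⟨N, hcl N x ⟨q, ?_, ?_⟩⟩
  · rintro rfl
    rw [Polynomial.map_zero, eq_comm, Polynomial.map_eq_zero] at hq'
    exact hp hq'
  · rw [Polynomial.aeval_def, ← Polynomial.eval_map] at hpx ⊢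
    exact (congrArg (Polynomial.eval x) hq').trans hpx

theorem mem_stab_iSup {U : ℕ → Subfield K} (hU : Monotone U) {σ : RingAut K}
    (hσ : ∀ n, σ ∈ stab (U n)) : σ ∈ stab (⨆ n, U n) := fun x => by
  rw [mem_iSup_nat hU, mem_iSup_nat hU]
  exact exists_congr fun n => hσ n x

/-- A coherent sequence of automorphisms along a chain with small union has a limit. -/
theorem exists_ringAut_limit [IsAlgClosed K] [Uncountable K] {U : ℕ → Subfield K}
    (hU : Monotone U) (hcard : #(⨆ n, U n : Subfield K) < #K) {h : ℕ → RingAut K}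
    (hh : ∀ n, ∀ x ∈ U n, h (n + 1) x = h n x) :
    ∃ h' : RingAut K, ∀ n, ∀ x ∈ U n, h' x = h n x := by
  have hle {m n : ℕ} (hmn : m ≤ n) {x : K} (hx : x ∈ U m) : h n x = h m x := by
    induction n, hmn using Nat.le_induction with
    | base => rfl
    | succ n hmn ih => rw [hh n x (hU hmn hx), ih]
  have hex (x : (⨆ n, U n : Subfield K)) : ∃ n, (x : K) ∈ U n := (mem_iSup_nat hU).mp x.2
  choose N hN using hex
  have hval (x : (⨆ n, U n : Subfield K)) {n : ℕ} (hx : (x : K) ∈ U n) : h (N x) x = h n x := by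
    rcases le_total (N x) n with hn | hn
    · exact (hle hn (hN x)).symm
    · exact hle hn hx
  have hcommon (x y : (⨆ n, U n : Subfield K)) : ∃ n, (x : K) ∈ U n ∧ (y : K) ∈ U n :=
    ⟨max (N x) (N y), hU (le_max_left _ _) (hN x), hU (le_max_right _ _) (hN y)⟩
  let j : (⨆ n, U n : Subfield K) →+* K :=
    { toFun := fun x => h (N x) x
      map_one' := map_one (h _)
      map_zero' := map_zero (h _)
      map_add' := fun x y => by
        obtain ⟨n, hx, hy⟩ := hcommon x y
        rw [hval x hx, hval y hy, hval (x + y) (add_mem hx hy)]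
        exact map_add (h n) _ _
      map_mul' := fun x y => by
        obtain ⟨n, hx, hy⟩ := hcommon x y
        rw [hval x hx, hval y hy, hval (x * y) (mul_mem hx hy)]
        exact map_mul (h n) _ _ }
  obtain ⟨h', hh'⟩ := exists_ringEquiv_comp_eq hcard (⨆ n, U n : Subfield K).subtype j
    (Subfield.subtype_injective _) j.injective
  exact ⟨h', fun n x hx => (hh' ⟨x, (mem_iSup_nat hU).mpr ⟨n, hx⟩⟩).trans (hval _ hx)⟩

/-- Two nested closed subfields `W ≤ Z` above `X`, with `f₁, f₂` acting on `Z`, `f₃, f₄` acting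
on `W` and `ν Ψ(f₃, f₄) = Ψ(f₁, f₂)` on `W`. -/
structure BackAndForth (X : Subfield K) (τ ν f₁ f₂ f₃ f₄ : RingAut K) (W Z : Subfield K) :
    Prop where
  base_le : X ≤ W
  le : W ≤ Z
  closed : RelAlgClosed W
  generated : ∃ S : Set K, S.Countable ∧ Z = acl (X ∪ S)
  τ_mem : τ ∈ stab W
  ν_mem : ν ∈ stab W
  τ_mem' : τ ∈ stab Z
  ν_mem' : ν ∈ stab Z
  f₁_mem : f₁ ∈ stab Z
  f₂_mem : f₂ ∈ stab Z
  f₃_mem : f₃ ∈ stab W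
  f₄_mem : f₄ ∈ stab W
  eqOn : ∀ w ∈ W, ν (psiAut τ f₃ f₄ w) = psiAut τ f₁ f₂ w

/-- Enlarging `f₃, f₄` so that the identity holds on `Z` exchanges the two sides. -/
theorem BackAndForth.step [IsAlgClosed K] [Uncountable K] {X : Subfield K} (hX : #X < #K)
    {τ ν f₁ f₂ f₃ f₄ : RingAut K} (hτ : ¬ IsBounded τ) {W Z : Subfield K}
    (h : BackAndForth X τ ν f₁ f₂ f₃ f₄ W Z) :
    ∃ (f₃' f₄' : RingAut K) (Z' : Subfield K), (∀ w ∈ W, f₃' w = f₃ w) ∧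
      (∀ w ∈ W, f₄' w = f₄ w) ∧ BackAndForth X τ ν⁻¹ f₃' f₄' f₁ f₂ Z Z' := by
  obtain ⟨S, hS, hZS⟩ := h.generated
  have hWS : acl (W ∪ S) = Z := by
    refine le_antisymm (acl_le (hZS ▸ relAlgClosed_acl _) (Set.union_subset h.le ?_)) ?_
    · exact hZS ▸ Set.subset_union_right.trans (subset_acl _)
    · rw [hZS]
      exact acl_mono (Set.union_subset_union_left _ h.base_le)
  have hWcard : #W < #K := by
    refine (mk_le_mk_of_subset h.le).trans_lt ?_
    rw [hZS]
    exact mk_acl_lt (mk_union_lt hX (mk_lt_of_countable hS))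
  obtain ⟨f₃', f₄', h₃, h₄, hΨ⟩ := exists_psiAut_eqOn (φ := ν⁻¹ * psiAut τ f₁ f₂) h.closed hWcard hτ
    h.τ_mem h.f₃_mem h.f₄_mem (fun w hw => ν.symm_apply_eq.mpr (h.eqOn w hw).symm) hS
    (hWS.symm ▸ mul_mem (inv_mem h.ν_mem') (psiAut_mem_stab h.τ_mem' h.f₁_mem h.f₂_mem))
  rw [hWS] at hΨ
  have h₃W := mem_stab_of_eqOn h.f₃_mem h₃
  have h₄W := mem_stab_of_eqOn h.f₄_mem h₄
  obtain ⟨T, hST, hT, hΓ⟩ := exists_countable_invariant {τ, ν, f₃', f₄'} (Set.to_countable _) hS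
  have hZZ : Z ≤ acl (W ∪ T) := hWS ▸ acl_mono (Set.union_subset_union_right _ hST)
  refine ⟨f₃', f₄', acl (W ∪ T), h₃, h₄,
    { base_le := h.base_le.trans h.le
      le := hZZ
      closed := hZS ▸ relAlgClosed_acl _
      generated := ⟨T, hT, le_antisymm (acl_le (relAlgClosed_acl _) (Set.union_subset ?_ ?_))
        (acl_mono (Set.union_subset_union_left _ h.base_le))⟩
      τ_mem := h.τ_mem'
      ν_mem := inv_mem h.ν_mem'
      τ_mem' := mem_stab_acl_of_image h.τ_mem (hΓ _ (by simp))
      ν_mem' := inv_mem (mem_stab_acl_of_image h.ν_mem (hΓ _ (by simp)))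
      f₁_mem := mem_stab_acl_of_image h₃W (hΓ _ (by simp))
      f₂_mem := mem_stab_acl_of_image h₄W (hΓ _ (by simp))
      f₃_mem := h.f₁_mem
      f₄_mem := h.f₂_mem
      eqOn := fun z hz => (hΨ z hz).symm }⟩
  · refine h.le.trans ?_
    rw [hZS]
    exact acl_mono (Set.union_subset_union_right _ hST)
  · exact Set.subset_union_right.trans (subset_acl _)

theorem BackAndForth.double_step [IsAlgClosed K] [Uncountable K] {X : Subfield K} (hX : #X < #K)
    {τ ν f₁ f₂ f₃ f₄ : RingAut K} (hτ : ¬ IsBounded τ) {W Z : Subfield K}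
    (h : BackAndForth X τ ν f₁ f₂ f₃ f₄ W Z) :
    ∃ (f₁' f₂' f₃' f₄' : RingAut K) (W' Z' : Subfield K), Z ≤ W' ∧ (∀ z ∈ Z, f₁' z = f₁ z) ∧
      (∀ z ∈ Z, f₂' z = f₂ z) ∧ (∀ w ∈ W, f₃' w = f₃ w) ∧ (∀ w ∈ W, f₄' w = f₄ w) ∧
      BackAndForth X τ ν f₁' f₂' f₃' f₄' W' Z' := by
  obtain ⟨f₃', f₄', W', h₃, h₄, h'⟩ := h.step hX hτ
  obtain ⟨f₁', f₂', Z', h₁, h₂, h''⟩ := h'.step hX hτ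
  rw [inv_inv] at h''
  exact ⟨f₁', f₂', f₃', f₄', W', Z', h'.le, h₁, h₂, h₃, h₄, h''⟩

end Chain

section Main

variable {K : Type u} [Field K]

theorem BackAndForth.exists_sequence [IsAlgClosed K] [Uncountable K] {X : Subfield K}
    (hX : #X < #K) {τ ν f₁ f₂ f₃ f₄ : RingAut K} (hτ : ¬ IsBounded τ) {W Z : Subfield K}
    (h : BackAndForth X τ ν f₁ f₂ f₃ f₄ W Z) :
    ∃ (g₁ g₂ g₃ g₄ : ℕ → RingAut K) (U V : ℕ → Subfield K),
      g₁ 0 = f₁ ∧ g₂ 0 = f₂ ∧ g₃ 0 = f₃ ∧ g₄ 0 = f₄ ∧ U 0 = W ∧ V 0 = Z ∧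
      (∀ n, V n ≤ U (n + 1)) ∧
      (∀ n, ∀ z ∈ V n, g₁ (n + 1) z = g₁ n z) ∧ (∀ n, ∀ z ∈ V n, g₂ (n + 1) z = g₂ n z) ∧
      (∀ n, ∀ w ∈ U n, g₃ (n + 1) w = g₃ n w) ∧ (∀ n, ∀ w ∈ U n, g₄ (n + 1) w = g₄ n w) ∧
      ∀ n, BackAndForth X τ ν (g₁ n) (g₂ n) (g₃ n) (g₄ n) (U n) (V n) := by
  let State := {s : (RingAut K × RingAut K) × (RingAut K × RingAut K) × (Subfield K × Subfield K) //
    BackAndForth X τ ν s.1.1 s.1.2 s.2.1.1 s.2.1.2 s.2.2.1 s.2.2.2}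
  have hnext (s : State) : ∃ t : State, s.1.2.2.2 ≤ t.1.2.2.1 ∧
      (∀ z ∈ s.1.2.2.2, t.1.1.1 z = s.1.1.1 z) ∧ (∀ z ∈ s.1.2.2.2, t.1.1.2 z = s.1.1.2 z) ∧
      (∀ w ∈ s.1.2.2.1, t.1.2.1.1 w = s.1.2.1.1 w) ∧
      ∀ w ∈ s.1.2.2.1, t.1.2.1.2 w = s.1.2.1.2 w := by
    obtain ⟨f₁', f₂', f₃', f₄', W', Z', hZ, h₁, h₂, h₃, h₄, h'⟩ := s.2.double_step hX hτ
    exact ⟨⟨((f₁', f₂'), (f₃', f₄'), (W', Z')), h'⟩, hZ, h₁, h₂, h₃, h₄⟩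
  choose next hle h₁ h₂ h₃ h₄ using hnext
  let s (n : ℕ) : State := n.rec ⟨((f₁, f₂), (f₃, f₄), (W, Z)), h⟩ fun _ => next
  exact ⟨fun n => (s n).1.1.1, fun n => (s n).1.1.2, fun n => (s n).1.2.1.1,
    fun n => (s n).1.2.1.2, fun n => (s n).1.2.2.1, fun n => (s n).1.2.2.2,
    rfl, rfl, rfl, rfl, rfl, rfl, fun n => hle (s n), fun n => h₁ (s n), fun n => h₂ (s n),
    fun n => h₃ (s n), fun n => h₄ (s n), fun n => (s n).2⟩

/-- `acl (X ∪ S)` is an acceptable extension of `X` if `S` is countable and contains an infinite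
family independent over `X`. -/
theorem acceptable_acl {X : Subfield K} {S : Set K} (hS : S.Countable) {b : ℕ → K}
    (hb : AlgebraicIndependent X b) (hbS : Set.range b ⊆ S) : Acceptable X (acl (X ∪ S)) := by
  obtain ⟨A, hbA, hAS, hA, hacl⟩ := exists_independent_acl_eq X hbS hb.coe_range
  refine ⟨fun x hx => subset_acl _ (.inl hx), A, hS.mono hAS,
    (Set.infinite_range_of_injective hb.injective).mono hbA, hA, ?_⟩
  rw [← hacl, coe_acl]

theorem exists_acceptable_extension [IsAlgClosed K] [Uncountable K] {X : Subfield K}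
    (hXcl : RelAlgClosed X) (hX : #X < #K) {τ ν f₁ f₂ f₃ f₄ : RingAut K} (hτ : ¬ IsBounded τ)
    (hτX : τ ∈ stab X) (hνX : ν ∈ stab X) (hf₁ : f₁ ∈ stab X) (hf₂ : f₂ ∈ stab X)
    (hf₃ : f₃ ∈ stab X) (hf₄ : f₄ ∈ stab X)
    (heq : ∀ x ∈ X, ν (psiAut τ f₃ f₄ x) = psiAut τ f₁ f₂ x) (a : K) :
    ∃ Y, Acceptable X Y ∧ a ∈ Y ∧ τ ∈ stab Y ∧ ν ∈ stab Y ∧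
      ∃ f₁' ∈ stab Y, ∃ f₂' ∈ stab Y, ∃ f₃' ∈ stab Y, ∃ f₄' ∈ stab Y,
        (∀ x ∈ X, f₁' x = f₁ x) ∧ (∀ x ∈ X, f₂' x = f₂ x) ∧ (∀ x ∈ X, f₃' x = f₃ x) ∧
        (∀ x ∈ X, f₄' x = f₄ x) ∧ ∀ y ∈ Y, ν (psiAut τ f₃' f₄' y) = psiAut τ f₁' f₂' y := by
  obtain ⟨b, hb⟩ := exists_independent_sequence hτ hX
  replace hb : AlgebraicIndependent X b := hb.comp Sum.inr Sum.inr_injective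
  obtain ⟨T, hST, hT, hΓ⟩ := exists_countable_invariant {τ, ν, f₁, f₂} (Set.to_countable _)
    ((Set.countable_range b).insert a)
  have hstart : BackAndForth X τ ν f₁ f₂ f₃ f₄ X (acl (X ∪ T)) :=
    { base_le := le_rfl
      le := fun x hx => subset_acl _ (.inl hx)
      closed := hXcl
      generated := ⟨T, hT, rfl⟩
      τ_mem := hτX
      ν_mem := hνX
      τ_mem' := mem_stab_acl_of_image hτX (hΓ _ (by simp))
      ν_mem' := mem_stab_acl_of_image hνX (hΓ _ (by simp))
      f₁_mem := mem_stab_acl_of_image hf₁ (hΓ _ (by simp))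
      f₂_mem := mem_stab_acl_of_image hf₂ (hΓ _ (by simp))
      f₃_mem := hf₃
      f₄_mem := hf₄
      eqOn := heq }
  obtain ⟨g₁, g₂, g₃, g₄, U, V, rfl, rfl, rfl, rfl, hU₀, hV₀, hVU, h₁, h₂, h₃, h₄, h⟩ :=
    hstart.exists_sequence hX hτ
  have hU : Monotone U := monotone_nat_of_le_succ fun n => (h n).le.trans (hVU n)
  have hV : Monotone V := monotone_nat_of_le_succ fun n => (hVU n).trans (h (n + 1)).le
  have hUV : ⨆ n, U n = ⨆ n, V n := le_antisymm (iSup_mono fun n => (h n).le)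
    (iSup_le fun n => (hVU n).trans (le_iSup U (n + 1)))
  choose S hS hVS using fun n => (h n).generated
  have hXV (n : ℕ) : X ≤ V n := (h n).base_le.trans (h n).le
  have hTV : T ⊆ V 0 := hV₀ ▸ Set.subset_union_right.trans (subset_acl _)
  have hY : ⨆ n, V n = acl (X ∪ (T ∪ ⋃ n, S n)) := by
    refine le_antisymm (iSup_le fun n => ?_) (acl_le ?_ (Set.union_subset ?_
      (Set.union_subset ?_ (Set.iUnion_subset fun n => ?_))))
    · rw [hVS n]
      exact acl_mono (Set.union_subset_union_right _
        ((Set.subset_iUnion S n).trans Set.subset_union_right))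
    · exact relAlgClosed_iSup hV fun n => hVS n ▸ relAlgClosed_acl _
    · exact (hXV 0).trans (le_iSup V 0)
    · exact hTV.trans (le_iSup V 0)
    · refine Set.Subset.trans ?_ (le_iSup V n)
      rw [hVS n]
      exact Set.subset_union_right.trans (subset_acl _)
  have hcount : (T ∪ ⋃ n, S n).Countable := hT.union (Set.countable_iUnion hS)
  have hYcard : #(⨆ n, V n : Subfield K) < #K := by
    rw [hY]
    exact mk_acl_lt (mk_union_lt hX (mk_lt_of_countable hcount))
  have hUcard : #(⨆ n, U n : Subfield K) < #K := by rwa [hUV]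
  obtain ⟨f₁', hf₁'⟩ := exists_ringAut_limit hV hYcard h₁
  obtain ⟨f₂', hf₂'⟩ := exists_ringAut_limit hV hYcard h₂
  obtain ⟨f₃', hf₃'⟩ := exists_ringAut_limit hU hUcard h₃
  obtain ⟨f₄', hf₄'⟩ := exists_ringAut_limit hU hUcard h₄
  refine ⟨⨆ n, V n, hY ▸ acceptable_acl hcount hb
      (((Set.subset_insert _ _).trans hST).trans Set.subset_union_left),
    le_iSup V 0 (hTV (hST (Set.mem_insert _ _))),
    mem_stab_iSup hV fun n => (h n).τ_mem', mem_stab_iSup hV fun n => (h n).ν_mem',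
    f₁', mem_stab_iSup hV fun n => mem_stab_of_eqOn (h n).f₁_mem (hf₁' n),
    f₂', mem_stab_iSup hV fun n => mem_stab_of_eqOn (h n).f₂_mem (hf₂' n),
    f₃', hUV ▸ mem_stab_iSup hU fun n => mem_stab_of_eqOn (h n).f₃_mem (hf₃' n),
    f₄', hUV ▸ mem_stab_iSup hU fun n => mem_stab_of_eqOn (h n).f₄_mem (hf₄' n),
    fun x hx => hf₁' 0 x (hXV 0 hx), fun x hx => hf₂' 0 x (hXV 0 hx),
    fun x hx => hf₃' 0 x ((h 0).base_le hx), fun x hx => hf₄' 0 x ((h 0).base_le hx),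
    fun y hy => ?_⟩
  obtain ⟨n, hn⟩ := (mem_iSup_nat hU).mp (hUV ▸ hy)
  rw [psiAut_congr (h n).τ_mem (h n).f₃_mem (h n).f₄_mem (hf₃' n) (hf₄' n) hn, (h n).eqOn y hn,
    psiAut_congr (h n).τ_mem' (h n).f₁_mem (h n).f₂_mem (hf₁' n) (hf₂' n) ((h n).le hn)]

/-- An automorphism of a small subfield extends to `K`. -/
theorem exists_ringAut_extend_subfield [IsAlgClosed K] [Uncountable K] {X : Subfield K}
    (hX : #X < #K) (f : X ≃+* X) : ∃ f' ∈ stab X, ∀ x : X, (f' : RingAut K) x = f x := by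
  obtain ⟨f', hf'⟩ := exists_ringEquiv_comp_eq hX X.subtype (X.subtype.comp f.toRingHom)
    X.subtype_injective (X.subtype_injective.comp f.injective)
  refine ⟨f', fun x => ⟨fun hx => ?_, fun hx => ?_⟩, hf'⟩
  · have h := hf' (f.symm ⟨f' x, hx⟩)
    have h' : f' ((f.symm ⟨f' x, hx⟩ : X) : K) = f' x := h.trans (by simp)
    exact f'.injective h' ▸ (f.symm _).2
  · exact (hf' ⟨x, hx⟩ : f' x = _) ▸ (f _).2

/-- `psiAut` restricted to an invariant subfield is `psi` of the restrictions. -/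
theorem coe_psi {U : Subfield K} {τ f g : RingAut K} {t f₀ g₀ : U ≃+* U}
    (ht : ∀ x : U, τ x = t x) (hf : ∀ x : U, f x = f₀ x) (hg : ∀ x : U, g x = g₀ x) (x : U) :
    (psi t f₀ g₀ x : K) = psiAut τ f g x := by
  have hinv {σ : RingAut K} {s : U ≃+* U} (h : ∀ x : U, σ x = s x) (x : U) :
      σ⁻¹ (x : K) = s.symm x := by
    have := h (s.symm x)
    rw [s.apply_symm_apply] at this
    exact σ.symm_apply_eq.mpr this.symm
  rw [psiAut_apply, hinv hf, hinv hg, hinv ht, hg, ht, hf]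
  rfl

theorem coe_restrict (σ : RingAut K) {U : Subfield K}
    (h : U.map ((σ : K ≃+* K) : K →+* K) = U) (x : U) : σ (x : K) = restrict σ U h x := rfl

end Main

/-- The successor step: if `ν|_X = Ψ_X(f₁,f₂) ∘ Ψ_X(f₃,f₄)⁻¹` on a small relatively
algebraically closed subfield `X` invariant under the unbounded automorphism `τ` and
under `ν`, then for any `a ∈ K` there is an acceptable extension `Y` of `X` containing
`a`, invariant under `τ` and `ν`, and automorphisms `f'ᵢ` of `Y` extending the `fᵢ`
with `ν|_Y = Ψ_Y(f'₁,f'₂) ∘ Ψ_Y(f'₃,f'₄)⁻¹`. -/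
theorem successor_step (K : Type*) [Field K] [IsAlgClosed K] [Uncountable K]
    (htr : FullTrdeg K)
    (τ : K ≃+* K) (hτu : ¬ IsBounded τ)
    (hτfix : ∀ a : K, IsAlgebraic (⊥ : Subfield K) a → τ a = a)
    (ν : K ≃+* K)
    (X : Subfield K) (hX1 : RelAlgClosed X) (hX2 : ContainsBotAlg X) (hX3 : SmallTrdeg X)
    (hXτ : X.map (τ : K →+* K) = X) (hXν : X.map (ν : K →+* K) = X)
    (f₁ f₂ f₃ f₄ : ↥X ≃+* ↥X)
    (hνX : restrict ν X hXν =
      ((psi (restrict τ X hXτ) f₃ f₄).symm).trans (psi (restrict τ X hXτ) f₁ f₂))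
    (a : K) :
    ∃ (Y : Subfield K) (hacc : Acceptable X Y), a ∈ Y ∧
      ∃ (hYτ : Y.map (τ : K →+* K) = Y) (hYν : Y.map (ν : K →+* K) = Y)
        (f₁' f₂' f₃' f₄' : ↥Y ≃+* ↥Y),
        (∀ x (hx : x ∈ X), (f₁' ⟨x, hacc.1 hx⟩ : K) = (f₁ ⟨x, hx⟩ : K)) ∧
        (∀ x (hx : x ∈ X), (f₂' ⟨x, hacc.1 hx⟩ : K) = (f₂ ⟨x, hx⟩ : K)) ∧
        (∀ x (hx : x ∈ X), (f₃' ⟨x, hacc.1 hx⟩ : K) = (f₃ ⟨x, hx⟩ : K)) ∧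
        (∀ x (hx : x ∈ X), (f₄' ⟨x, hacc.1 hx⟩ : K) = (f₄ ⟨x, hx⟩ : K)) ∧
        restrict ν Y hYν =
          ((psi (restrict τ Y hYτ) f₃' f₄').symm).trans
            (psi (restrict τ Y hYτ) f₁' f₂') := by
  have hX := hX3.mk_lt
  obtain ⟨F₁, hF₁, h₁⟩ := exists_ringAut_extend_subfield hX f₁
  obtain ⟨F₂, hF₂, h₂⟩ := exists_ringAut_extend_subfield hX f₂
  obtain ⟨F₃, hF₃, h₃⟩ := exists_ringAut_extend_subfield hX f₃
  obtain ⟨F₄, hF₄, h₄⟩ := exists_ringAut_extend_subfield hX f₄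
  have hτr := coe_restrict τ hXτ
  have heq : ∀ x ∈ X, ν (psiAut τ F₃ F₄ x) = psiAut τ F₁ F₂ x := fun x hx => by
    have h := congrArg (fun e : X ≃+* X => (e (psi (restrict τ X hXτ) f₃ f₄ ⟨x, hx⟩) : K)) hνX
    simp only [RingEquiv.trans_apply, RingEquiv.symm_apply_apply] at h
    rw [coe_psi hτr h₁ h₂, ← coe_restrict ν hXν, coe_psi hτr h₃ h₄] at h
    exact h
  obtain ⟨Y, hacc, ha, hτY, hνY, F₁', hF₁', F₂', hF₂', F₃', hF₃', F₄', hF₄', e₁, e₂, e₃, e₄, hY⟩ :=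
    exists_acceptable_extension hX1 hX hτu (mem_stab_iff_map.mpr hXτ) (mem_stab_iff_map.mpr hXν)
      hF₁ hF₂ hF₃ hF₄ heq a
  rw [mem_stab_iff_map] at hτY hνY hF₁' hF₂' hF₃' hF₄'
  refine ⟨Y, hacc, ha, hτY, hνY, restrict F₁' Y hF₁', restrict F₂' Y hF₂', restrict F₃' Y hF₃',
    restrict F₄' Y hF₄', fun x hx => (e₁ x hx).trans (h₁ ⟨x, hx⟩),
    fun x hx => (e₂ x hx).trans (h₂ ⟨x, hx⟩), fun x hx => (e₃ x hx).trans (h₃ ⟨x, hx⟩),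
    fun x hx => (e₄ x hx).trans (h₄ ⟨x, hx⟩), RingEquiv.ext fun y => Subtype.ext ?_⟩
  obtain ⟨y, rfl⟩ :=
    (psi (restrict τ Y hτY) (restrict F₃' Y hF₃') (restrict F₄' Y hF₄')).surjective y
  have hτr' := coe_restrict τ hτY
  rw [RingEquiv.trans_apply, RingEquiv.symm_apply_apply, ← coe_restrict ν hνY,
    coe_psi hτr' (coe_restrict F₃' hF₃') (coe_restrict F₄' hF₄'),
    coe_psi hτr' (coe_restrict F₁' hF₁') (coe_restrict F₂' hF₂')]
  exact hY y y.2
end
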